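/- Suppose Assumptions 1 and 2 hold, let λ ∈ (0,1), and assume the quantization parameters (M, Δ) ∈ ℝ²_{>0} and the sampling parameters (h, σ) ∈ (0, τ̃_min(λ)] × (0, σ₀] satisfy (Δ/M)(e^{d₁h} + ν(h)) + Γν(h) ≤ σ. Then for every q ∈ B_cl(λR): (i) the ODE ẋ_q(t) = f_q(x_q(t)) with x_q(0) = q has a unique solution x_q on [0,h] and x_q(τ) ∈ B_op(R₂) for all τ ∈ [0,h]; and (ii) for every μ > 0, if q = Q_μ(x) for some x ∈ B_cl(Mμ), then ψ_zo(τ, q, μ) < σMμ for all τ ∈ [0,h]. -/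

import Mathlib

set_option autoImplicit false

open Filter Set MeasureTheory Real
open scoped Topology ENNReal

noncomputable section

/-- `N` is a norm on `ℝ^n`. -/
structure IsVecNorm {n : ℕ} (N : (Fin n → ℝ) → ℝ) : Prop where
  eq_zero : ∀ x, N x = 0 ↔ x = 0
  smul_eq : ∀ (a : ℝ) (x : Fin n → ℝ), N (a • x) = |a| * N x
  add_le : ∀ x y : Fin n → ℝ, N (x + y) ≤ N x + N y

/-- The matrix norm induced by the vector norm `N`. -/
def matNorm {n : ℕ} (N : (Fin n → ℝ) → ℝ) (A : Matrix (Fin n) (Fin n) ℝ) : ℝ :=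
  sSup {c : ℝ | ∃ x : Fin n → ℝ, N x = 1 ∧ c = N (A.mulVec x)}

/-- The logarithmic norm `μ_N(A) = lim_{ε→0⁺} (‖I+εA‖_N − 1)/ε`. -/
def logNorm {n : ℕ} (N : (Fin n → ℝ) → ℝ) (A : Matrix (Fin n) (Fin n) ℝ) : ℝ :=
  limUnder (𝓝[>] (0 : ℝ)) (fun ε : ℝ => (matNorm N (1 + ε • A) - 1) / ε)

/-- The Jacobian matrix of `F` at `x`. -/
def jacobian {n : ℕ} (F : (Fin n → ℝ) → (Fin n → ℝ)) (x : Fin n → ℝ) :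
    Matrix (Fin n) (Fin n) ℝ :=
  Matrix.of fun i j => fderiv ℝ F x (Pi.single j 1) i

/-- Open ball of radius `r` centered at `0` w.r.t. the norm `N`. -/
def nball {n : ℕ} (N : (Fin n → ℝ) → ℝ) (r : ℝ) : Set (Fin n → ℝ) := {x | N x < r}

/-- `ν(t) = d₂ ∫₀ᵗ e^{d₁ s} ds`. -/
def nu (d₁ d₂ t : ℝ) : ℝ := d₂ * ∫ s in (0:ℝ)..t, Real.exp (d₁ * s)

/-- Diagonally-weighted r-norm `‖x‖_{r,[θ]} = ‖[θ]x‖_r`. -/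
def wnorm {n : ℕ} (r : ℝ≥0∞) (θ x : Fin n → ℝ) : ℝ :=
  ‖(WithLp.equiv r (∀ _ : Fin n, ℝ)).symm (fun i => θ i * x i)‖

theorem IsVecNorm.zero {n : ℕ} {N : (Fin n → ℝ) → ℝ} (hN : IsVecNorm N) : N 0 = 0 :=
  (hN.eq_zero 0).2 rfl

theorem IsVecNorm.neg {n : ℕ} {N : (Fin n → ℝ) → ℝ} (hN : IsVecNorm N) (x : Fin n → ℝ) :
    N (-x) = N x := by
  have := hN.smul_eq (-1) x
  simpa using this

theorem IsVecNorm.nonneg {n : ℕ} {N : (Fin n → ℝ) → ℝ} (hN : IsVecNorm N) (x : Fin n → ℝ) :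
    0 ≤ N x := by
  have := hN.add_le x (-x)
  rw [add_neg_cancel, hN.zero, hN.neg] at this
  linarith

theorem IsVecNorm.sub_le {n : ℕ} {N : (Fin n → ℝ) → ℝ} (hN : IsVecNorm N) (x y : Fin n → ℝ) :
    N x - N y ≤ N (x - y) := by
  have := hN.add_le (x - y) y
  rw [sub_add_cancel] at this
  linarith

theorem IsVecNorm.sum_le {n : ℕ} {N : (Fin n → ℝ) → ℝ} (hN : IsVecNorm N) {ι : Type*}
    (s : Finset ι) (v : ι → Fin n → ℝ) : N (∑ i ∈ s, v i) ≤ ∑ i ∈ s, N (v i) := by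
  classical
  induction s using Finset.induction_on with
  | empty => simp [hN.zero]
  | insert a s ha ih =>
    rw [Finset.sum_insert ha, Finset.sum_insert ha]
    exact (hN.add_le _ _).trans (by linarith)

theorem IsVecNorm.exists_upper {n : ℕ} {N : (Fin n → ℝ) → ℝ} (hN : IsVecNorm N) :
    ∃ C : ℝ, 0 ≤ C ∧ ∀ x, N x ≤ C * ‖x‖ := by
  refine ⟨∑ i, N (Pi.single i 1), Finset.sum_nonneg fun i _ => hN.nonneg _, fun x => ?_⟩
  have hx : x = ∑ i, x i • (Pi.single i (1:ℝ) : Fin n → ℝ) := by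
    simpa using pi_eq_sum_univ' x
  calc N x = N (∑ i, x i • (Pi.single i (1:ℝ) : Fin n → ℝ)) := by rw [← hx]
    _ ≤ ∑ i, N (x i • (Pi.single i (1:ℝ) : Fin n → ℝ)) := hN.sum_le _ _
    _ ≤ ∑ i, N (Pi.single i 1) * ‖x‖ := by
        refine Finset.sum_le_sum fun i _ => ?_
        rw [hN.smul_eq, mul_comm]
        exact mul_le_mul_of_nonneg_left (norm_le_pi_norm x i) (hN.nonneg _)
    _ = _ := by rw [Finset.sum_mul]

theorem IsVecNorm.continuous {n : ℕ} {N : (Fin n → ℝ) → ℝ} (hN : IsVecNorm N) :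
    Continuous N := by
  obtain ⟨C, hC, hCN⟩ := hN.exists_upper
  refine (LipschitzWith.of_le_add_mul C.toNNReal fun x y => ?_).continuous
  have := hN.sub_le x y
  have := hCN (x - y)
  rw [dist_eq_norm, Real.coe_toNNReal C hC]
  linarith

theorem IsVecNorm.exists_lower {n : ℕ} {N : (Fin n → ℝ) → ℝ} (hN : IsVecNorm N) :
    ∃ C : ℝ, 0 ≤ C ∧ ∀ x, ‖x‖ ≤ C * N x := by
  by_cases hne : (Metric.sphere (0 : Fin n → ℝ) 1).Nonempty
  · obtain ⟨z, hz, hmin⟩ := (isCompact_sphere (0 : Fin n → ℝ) 1).exists_isMinOn hne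
      hN.continuous.continuousOn
    have hzN : 0 < N z := by
      refine lt_of_le_of_ne (hN.nonneg z) fun h0 => ?_
      have := (hN.eq_zero z).1 h0.symm
      simp [this] at hz
    refine ⟨(N z)⁻¹, by positivity, fun x => ?_⟩
    by_cases hx : x = 0
    · simp [hx, hN.zero]
    have hxn : 0 < ‖x‖ := norm_pos_iff.2 hx
    have h1 : N z ≤ N (‖x‖⁻¹ • x) := hmin (by simp [norm_smul, hxn.ne'])
    rw [hN.smul_eq, abs_of_pos (by positivity)] at h1
    field_simp at h1 ⊢
    linarith
  · refine ⟨0, le_rfl, fun x => ?_⟩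
    by_contra hx
    have hxn : 0 < ‖x‖ := by simpa using hx
    exact hne ⟨‖x‖⁻¹ • x, by simp [norm_smul, hxn.ne']⟩

theorem IsVecNorm.isCompact_le {n : ℕ} {N : (Fin n → ℝ) → ℝ} (hN : IsVecNorm N) (r : ℝ) :
    IsCompact {x | N x ≤ r} := by
  obtain ⟨C, hC, hCN⟩ := hN.exists_lower
  refine Metric.isCompact_of_isClosed_isBounded (isClosed_le hN.continuous continuous_const) ?_
  refine (Metric.isBounded_closedBall (x := (0 : Fin n → ℝ)) (r := C * r)).subset fun x hx => ?_
  simp only [Metric.mem_closedBall, dist_zero_right]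
  exact (hCN x).trans (mul_le_mul_of_nonneg_left hx hC)

theorem IsVecNorm.convexOn {n : ℕ} {N : (Fin n → ℝ) → ℝ} (hN : IsVecNorm N) :
    ConvexOn ℝ univ N := by
  refine ⟨convex_univ, fun x _ y _ a b ha hb _ => ?_⟩
  have := hN.add_le (a • x) (b • y)
  rwa [hN.smul_eq, hN.smul_eq, abs_of_nonneg ha, abs_of_nonneg hb] at this

theorem IsVecNorm.bdd {n : ℕ} {N : (Fin n → ℝ) → ℝ} (hN : IsVecNorm N)
    (A : Matrix (Fin n) (Fin n) ℝ) :
    BddAbove {c : ℝ | ∃ x : Fin n → ℝ, N x = 1 ∧ c = N (A.mulVec x)} := by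
  have hc : Continuous fun x : Fin n → ℝ => N (A.mulVec x) :=
    hN.continuous.comp (Continuous.matrix_mulVec continuous_const continuous_id)
  refine ((hN.isCompact_le 1).bddAbove_image hc.continuousOn).mono ?_
  rintro c ⟨x, hx, rfl⟩
  exact ⟨x, hx.le, rfl⟩

theorem IsVecNorm.mulVec_le {n : ℕ} {N : (Fin n → ℝ) → ℝ} (hN : IsVecNorm N)
    (A : Matrix (Fin n) (Fin n) ℝ) (x : Fin n → ℝ) : N (A.mulVec x) ≤ matNorm N A * N x := by
  by_cases hx : x = 0
  · simp [hx, hN.zero]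
  have hxn : 0 < N x := lt_of_le_of_ne (hN.nonneg x) fun h => hx ((hN.eq_zero x).1 h.symm)
  have h1 : N (A.mulVec ((N x)⁻¹ • x)) ≤ matNorm N A := by
    refine le_csSup (hN.bdd A) ⟨(N x)⁻¹ • x, ?_, rfl⟩
    rw [hN.smul_eq, abs_of_pos (by positivity)]
    field_simp
  rw [Matrix.mulVec_smul, hN.smul_eq, abs_of_pos (by positivity)] at h1
  field_simp at h1
  linarith

theorem IsVecNorm.exists_unit {n : ℕ} (hn : 0 < n) {N : (Fin n → ℝ) → ℝ} (hN : IsVecNorm N) :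
    ∃ x, N x = 1 := by
  let e : Fin n → ℝ := Pi.single ⟨0, hn⟩ 1
  have he : e ≠ 0 := by
    intro h
    have := congrFun h ⟨0, hn⟩
    simp [e] at this
  have hxn : 0 < N e := lt_of_le_of_ne (hN.nonneg e) fun h => he ((hN.eq_zero e).1 h.symm)
  refine ⟨(N e)⁻¹ • e, ?_⟩
  rw [hN.smul_eq, abs_of_pos (by positivity)]
  field_simp

theorem IsVecNorm.matNorm_le {n : ℕ} (hn : 0 < n) {N : (Fin n → ℝ) → ℝ} (hN : IsVecNorm N)
    (A : Matrix (Fin n) (Fin n) ℝ) (c : ℝ) (h : ∀ x, N x = 1 → N (A.mulVec x) ≤ c) :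
    matNorm N A ≤ c := by
  obtain ⟨x, hx⟩ := hN.exists_unit hn
  refine csSup_le ⟨_, x, hx, rfl⟩ ?_
  rintro _ ⟨y, hy, rfl⟩
  exact h y hy

theorem IsVecNorm.tendsto_logNorm {n : ℕ} (hn : 0 < n) {N : (Fin n → ℝ) → ℝ} (hN : IsVecNorm N)
    (A : Matrix (Fin n) (Fin n) ℝ) :
    Tendsto (fun ε : ℝ => (matNorm N (1 + ε • A) - 1) / ε) (𝓝[>] 0) (𝓝 (logNorm N A)) := by
  have hmono : MonotoneOn (fun ε : ℝ => (matNorm N (1 + ε • A) - 1) / ε) (Ioi 0) := by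
    intro a ha b hb hab
    have ha : 0 < a := ha
    have hb : 0 < b := hb
    have key : matNorm N (1 + a • A) ≤ (1 - a / b) + a / b * matNorm N (1 + b • A) := by
      refine hN.matNorm_le hn _ _ fun x hx => ?_
      have h1 : (1 + a • A).mulVec x = (1 - a / b) • x + (a / b) • (1 + b • A).mulVec x := by
        simp only [Matrix.add_mulVec, Matrix.one_mulVec, Matrix.smul_mulVec]
        ext i
        simp
        field_simp
        ring
      have h2 := hN.mulVec_le (1 + b • A) x
      have h3 : 0 ≤ 1 - a / b := by
        rw [sub_nonneg, div_le_one hb]; exact hab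
      have h4 : 0 ≤ a / b := by positivity
      rw [h1]
      refine (hN.add_le _ _).trans ?_
      rw [hN.smul_eq, hN.smul_eq, abs_of_nonneg h3, abs_of_nonneg h4, hx]
      rw [hx] at h2
      nlinarith
    show (matNorm N (1 + a • A) - 1) / a ≤ (matNorm N (1 + b • A) - 1) / b
    rw [div_le_iff₀ ha]
    calc _ ≤ a / b * (matNorm N (1 + b • A) - 1) := by linarith
      _ = _ := by ring
  have hbdd : BddBelow ((fun ε : ℝ => (matNorm N (1 + ε • A) - 1) / ε) '' (Ioi 0)) := by
    obtain ⟨x, hx⟩ := hN.exists_unit hn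
    refine ⟨-N (A.mulVec x), ?_⟩
    rintro _ ⟨ε, hε, rfl⟩
    have hε : 0 < ε := hε
    show _ ≤ (matNorm N (1 + ε • A) - 1) / ε
    rw [le_div_iff₀ hε]
    have h1 := hN.mulVec_le (1 + ε • A) x
    have h2 := hN.sub_le x (-(ε • A.mulVec x))
    rw [Matrix.add_mulVec, Matrix.one_mulVec, Matrix.smul_mulVec, hx] at h1
    rw [hN.neg, hN.smul_eq, abs_of_pos hε, hx, sub_neg_eq_add] at h2
    linarith
  have := hmono.tendsto_nhdsGT hbdd
  have h2 := this.limUnder_eq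
  unfold logNorm
  rw [h2]
  exact this

theorem IsVecNorm.exists_support {n : ℕ} {N : (Fin n → ℝ) → ℝ} (hN : IsVecNorm N)
    (v : Fin n → ℝ) : ∃ l : (Fin n → ℝ) →L[ℝ] ℝ, l v = N v ∧ ∀ x, l x ≤ N x := by
  by_cases hv : v = 0
  · exact ⟨0, by simp [hv, hN.zero], fun x => by simpa using hN.nonneg x⟩
  obtain ⟨l, h1, h2⟩ := exists_extension_of_le_sublinear
    (LinearPMap.mkSpanSingleton (σ := RingHom.id ℝ) v (N v) hv) N
    (fun c hc x => by rw [hN.smul_eq, abs_of_pos hc]) hN.add_le (by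
      rintro ⟨x, hx⟩
      obtain ⟨a, rfl⟩ := Submodule.mem_span_singleton.1 hx
      have := LinearPMap.mkSpanSingleton'_apply (σ := RingHom.id ℝ) v (N v)
        (fun c hc => by simp [(smul_eq_zero.1 hc).resolve_right hv]) a hx
      refine (le_of_eq this).trans ?_
      simp only [RingHom.id_apply, smul_eq_mul, hN.smul_eq]
      exact mul_le_mul_of_nonneg_right (le_abs_self a) (hN.nonneg v))
  refine ⟨LinearMap.toContinuousLinearMap l, ?_, h2⟩
  exact (h1 ⟨v, Submodule.mem_span_singleton_self v⟩).trans
    (LinearPMap.mkSpanSingleton_apply (σ := RingHom.id ℝ) ℝ ℝ hv (N v))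

theorem jacobian_mulVec {n : ℕ} (F : (Fin n → ℝ) → (Fin n → ℝ)) (x v : Fin n → ℝ) :
    (jacobian F x).mulVec v = fderiv ℝ F x v := by
  have : jacobian F x = LinearMap.toMatrix' (fderiv ℝ F x : (Fin n → ℝ) →ₗ[ℝ] (Fin n → ℝ)) := by
    ext i j
    simp [jacobian, LinearMap.toMatrix'_apply]
  rw [this, LinearMap.toMatrix'_mulVec]
  rfl

/-- A supporting functional sees the logarithmic norm. -/
theorem IsVecNorm.support_mulVec_le {n : ℕ} (hn : 0 < n) {N : (Fin n → ℝ) → ℝ}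
    (hN : IsVecNorm N) (A : Matrix (Fin n) (Fin n) ℝ) (v : Fin n → ℝ)
    (l : (Fin n → ℝ) →L[ℝ] ℝ) (hlv : l v = N v) (hl : ∀ x, l x ≤ N x) :
    l (A.mulVec v) ≤ logNorm N A * N v := by
  refine ge_of_tendsto ((hN.tendsto_logNorm hn A).mul_const (N v)) ?_
  filter_upwards [self_mem_nhdsWithin] with ε hε
  have hε : 0 < ε := hε
  have h1 := (hl _).trans (hN.mulVec_le (1 + ε • A) v)
  rw [Matrix.add_mulVec, Matrix.one_mulVec, Matrix.smul_mulVec, map_add, map_smul, hlv,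
    smul_eq_mul] at h1
  rw [div_mul_eq_mul_div, le_div_iff₀ hε]
  linarith

theorem IsVecNorm.isOpen_nball {n : ℕ} {N : (Fin n → ℝ) → ℝ} (hN : IsVecNorm N) (r : ℝ) :
    IsOpen (nball N r) := isOpen_lt hN.continuous continuous_const

theorem IsVecNorm.convex_nball {n : ℕ} {N : (Fin n → ℝ) → ℝ} (hN : IsVecNorm N) (r : ℝ) :
    Convex ℝ (nball N r) := by
  have := hN.convexOn.convex_lt r
  simpa [nball] using this

/-- One-sided Lipschitz estimate. -/
theorem IsVecNorm.one_sided {n : ℕ} (hn : 0 < n) {N : (Fin n → ℝ) → ℝ}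
    (hN : IsVecNorm N) (F : (Fin n → ℝ) → (Fin n → ℝ)) (r d : ℝ)
    (hF : ContDiffOn ℝ 1 F (nball N r))
    (hd : ∀ x ∈ nball N r, logNorm N (jacobian F x) ≤ d)
    (q x : Fin n → ℝ) (hq : q ∈ nball N r) (hx : x ∈ nball N r)
    (l : (Fin n → ℝ) →L[ℝ] ℝ) (hlv : l (x - q) = N (x - q)) (hl : ∀ x, l x ≤ N x) :
    l (F x - F q) ≤ d * N (x - q) := by
  have hseg : ∀ t ∈ Icc (0:ℝ) 1, q + t • (x - q) ∈ nball N r := fun t ht =>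
    (hN.convex_nball r).add_smul_sub_mem hq hx ht
  have hder : ∀ t ∈ Icc (0:ℝ) 1, HasDerivAt (fun t : ℝ => l (F (q + t • (x - q))))
      (l (fderiv ℝ F (q + t • (x - q)) (x - q))) t := by
    intro t ht
    have h1 : HasFDerivAt F (fderiv ℝ F (q + t • (x - q))) (q + t • (x - q)) :=
      ((hF.contDiffAt ((hN.isOpen_nball r).mem_nhds (hseg t ht))).differentiableAt
        (by simp)).hasFDerivAt
    have h2 : HasDerivAt (fun t : ℝ => q + t • (x - q)) (x - q) t := by
      simpa using ((hasDerivAt_id t).smul_const (x - q)).const_add q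
    exact l.hasFDerivAt.comp_hasDerivAt t (h1.comp_hasDerivAt t h2)
  obtain ⟨t, ht, hte⟩ := exists_hasDerivAt_eq_slope _ _ (zero_lt_one' ℝ)
    (fun t ht => (hder t ht).continuousAt.continuousWithinAt)
    (fun t ht => hder t (Ioo_subset_Icc_self ht))
  have h3 := hN.support_mulVec_le hn (jacobian F (q + t • (x - q))) (x - q) l hlv hl
  rw [jacobian_mulVec, hte] at h3
  have h4 := mul_le_mul_of_nonneg_right (hd _ (hseg t (Ioo_subset_Icc_self ht)))
    (hN.nonneg (x - q))
  simp at h3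
  rw [map_sub]
  linarith

theorem hasDerivAt_expInt (d t : ℝ) :
    HasDerivAt (fun t : ℝ => ∫ s in (0:ℝ)..t, Real.exp (d * s)) (Real.exp (d * t)) t := by
  have hc : Continuous fun s : ℝ => Real.exp (d * s) := by fun_prop
  exact intervalIntegral.integral_hasDerivAt_right (hc.intervalIntegrable _ _)
    hc.aestronglyMeasurable.stronglyMeasurableAtFilter hc.continuousAt

theorem hasDerivAt_exp_mul (d t : ℝ) :
    HasDerivAt (fun t : ℝ => Real.exp (d * t)) (d * Real.exp (d * t)) t := by
  have := ((hasDerivAt_id t).const_mul d).exp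
  simpa [mul_comm] using this

theorem mul_expInt (d t : ℝ) :
    d * ∫ s in (0:ℝ)..t, Real.exp (d * s) = Real.exp (d * t) - 1 := by
  have := intervalIntegral.integral_eq_sub_of_hasDerivAt (a := 0) (b := t)
    (fun s _ => hasDerivAt_exp_mul d s)
    ((by fun_prop : Continuous fun s : ℝ => d * Real.exp (d * s)).intervalIntegrable _ _)
  simpa using this

theorem expInt_mono (d : ℝ) : Monotone fun t : ℝ => ∫ s in (0:ℝ)..t, Real.exp (d * s) :=
  monotone_of_deriv_nonneg (fun t => (hasDerivAt_expInt d t).differentiableAt)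
    (fun t => by rw [(hasDerivAt_expInt d t).deriv]; positivity)

theorem expInt_pos (d : ℝ) {t : ℝ} (ht : 0 < t) : 0 < ∫ s in (0:ℝ)..t, Real.exp (d * s) :=
  intervalIntegral.intervalIntegral_pos_of_pos
    ((by fun_prop : Continuous fun s : ℝ => Real.exp (d * s)).intervalIntegrable _ _)
    (fun s => by positivity) ht

/-- First-contact comparison. -/
theorem apriori_aux {n : ℕ} {N : (Fin n → ℝ) → ℝ} (hN : IsVecNorm N)
    (F : (Fin n → ℝ) → (Fin n → ℝ)) (q : Fin n → ℝ) (ρ d b δ h : ℝ) (hd : 0 ≤ d) (hδ : 0 < δ)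
    (hb : N (F q) ≤ b)
    (hos : ∀ x, N x < ρ → ∀ l : (Fin n → ℝ) →L[ℝ] ℝ, l (x - q) = N (x - q) →
      (∀ x, l x ≤ N x) → l (F x - F q) ≤ d * N (x - q))
    (hρ : N q + ((b + δ) * (∫ s in (0:ℝ)..h, Real.exp (d * s)) + δ * Real.exp (d * h)) < ρ)
    (y v : ℝ → Fin n → ℝ) (hy0 : y 0 = q)
    (hy : ∀ s ∈ Icc (0:ℝ) h, HasDerivWithinAt y (v s) (Icc 0 h) s)
    (hv : ∀ s, N (y s) < ρ → v s = F (y s)) :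
    ∀ s ∈ Icc (0:ℝ) h, N (y s - q) ≤
      (b + δ) * (∫ s in (0:ℝ)..s, Real.exp (d * s)) + δ * Real.exp (d * s) := by
  set B : ℝ → ℝ := fun s => (b + δ) * (∫ s in (0:ℝ)..s, Real.exp (d * s)) + δ * Real.exp (d * s)
    with hB
  have hb0 : 0 ≤ b := (hN.nonneg _).trans hb
  have hBmono : Monotone B := by
    intro s t hst
    have h1 := expInt_mono d hst
    have h2 : Real.exp (d * s) ≤ Real.exp (d * t) :=
      Real.exp_le_exp.2 (mul_le_mul_of_nonneg_left hst hd)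
    simp only [hB]
    exact add_le_add (mul_le_mul_of_nonneg_left h1 (by positivity))
      (mul_le_mul_of_nonneg_left h2 hδ.le)
  have hBder : ∀ t, HasDerivAt B (d * B t + (b + δ)) t := by
    intro t
    have h1 := ((hasDerivAt_expInt d t).const_mul (b + δ)).add
      ((hasDerivAt_exp_mul d t).const_mul δ)
    have h2 := mul_expInt d t
    convert! h1 using 1
    simp only [hB]
    linear_combination (b + δ) * h2
  have hBc : Continuous B := continuous_iff_continuousAt.2 fun t => (hBder t).continuousAt
  have hyc : ContinuousOn y (Icc 0 h) := fun s hs => (hy s hs).continuousWithinAt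
  have hGc : ContinuousOn (fun s => N (y s - q)) (Icc 0 h) :=
    hN.continuous.comp_continuousOn (hyc.sub continuousOn_const)
  intro s₀ hs₀
  by_contra hcon
  push Not at hcon
  -- the set of bad times
  set S : Set ℝ := {s ∈ Icc (0:ℝ) h | B s ≤ N (y s - q)} with hS
  have hSc : IsClosed S := isClosed_Icc.isClosed_le hBc.continuousOn hGc
  have hSne : S.Nonempty := ⟨s₀, hs₀, hcon.le⟩
  have hSb : BddBelow S := ⟨0, fun s hs => hs.1.1⟩
  have htS : sInf S ∈ S := hSc.csInf_mem hSne hSb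
  set t := sInf S with ht
  have hlt : ∀ s ∈ Icc (0:ℝ) h, s < t → N (y s - q) < B s := by
    intro s hs hst
    by_contra hc
    push Not at hc
    exact absurd (csInf_le hSb ⟨hs, hc⟩) (not_le.2 hst)
  have ht0 : 0 < t := by
    refine lt_of_le_of_ne htS.1.1 fun h0 => ?_
    have := htS.2
    rw [← h0, hy0, sub_self, hN.zero] at this
    simp [hB] at this
    linarith
  have hle : N (y t - q) ≤ B t := by
    have hne : (𝓝[Ico 0 t] t).NeBot := by
      rw [← mem_closure_iff_nhdsWithin_neBot, closure_Ico ht0.ne]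
      exact right_mem_Icc.2 ht0.le
    have hsub : Ico 0 t ⊆ Icc 0 h := fun s hs => ⟨hs.1, hs.2.le.trans htS.1.2⟩
    refine le_of_tendsto_of_tendsto ((hGc t htS.1).mono hsub).tendsto
      (hBc.continuousAt.continuousWithinAt (s := Ico 0 t)).tendsto ?_
    filter_upwards [self_mem_nhdsWithin] with s hs
    exact (hlt s (hsub hs) hs.2).le
  have heq : N (y t - q) = B t := le_antisymm hle htS.2
  have hyt : N (y t) < ρ := by
    have h1 := hN.sub_le (y t) q
    have h2 := hBmono htS.1.2
    have h3 : N q + B h < ρ := hρ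
    linarith
  obtain ⟨l, hl1, hl2⟩ := hN.exists_support (y t - q)
  have h1 := hos (y t) hyt l hl1 hl2
  have h2 : l (F q) ≤ b := (hl2 _).trans hb
  have h3 : HasDerivWithinAt (fun s => l (y s - q) - B s) (l (v t) - (d * B t + (b + δ)))
      (Icc 0 t) t := by
    have h4 := ((hy t htS.1).mono (Icc_subset_Icc_right htS.1.2)).sub_const q
    exact (l.hasFDerivAt.comp_hasDerivWithinAt t h4).sub (hBder t).hasDerivWithinAt
  have h5 : 0 ≤ l (v t) - (d * B t + (b + δ)) := by
    rw [hasDerivWithinAt_iff_tendsto_slope] at h3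
    have hne : (𝓝[Icc 0 t \ {t}] t).NeBot := by
      rw [show Icc 0 t \ {t} = Ico 0 t by ext z; simp [lt_iff_le_and_ne, and_assoc], ← mem_closure_iff_nhdsWithin_neBot, closure_Ico ht0.ne]
      exact right_mem_Icc.2 ht0.le
    refine ge_of_tendsto h3 ?_
    filter_upwards [self_mem_nhdsWithin] with s hs
    have hst : s < t := lt_of_le_of_ne hs.1.2 hs.2
    have h7 := hlt s ⟨hs.1.1, hs.1.2.trans htS.1.2⟩ hst
    have h8 := hl2 (y s - q)
    rw [slope_def_field]
    refine div_nonneg_of_nonpos ?_ (by linarith)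
    rw [hl1, heq]
    linarith
  rw [hv t hyt] at h5
  rw [map_sub, heq] at h1
  linarith

theorem apriori {n : ℕ} {N : (Fin n → ℝ) → ℝ} (hN : IsVecNorm N)
    (F : (Fin n → ℝ) → (Fin n → ℝ)) (q : Fin n → ℝ) (ρ d b h : ℝ) (hd : 0 ≤ d)
    (hb : N (F q) ≤ b)
    (hos : ∀ x, N x < ρ → ∀ l : (Fin n → ℝ) →L[ℝ] ℝ, l (x - q) = N (x - q) →
      (∀ x, l x ≤ N x) → l (F x - F q) ≤ d * N (x - q))
    (hρ : N q + b * (∫ s in (0:ℝ)..h, Real.exp (d * s)) < ρ)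
    (y v : ℝ → Fin n → ℝ) (hy0 : y 0 = q)
    (hy : ∀ s ∈ Icc (0:ℝ) h, HasDerivWithinAt y (v s) (Icc 0 h) s)
    (hv : ∀ s, N (y s) < ρ → v s = F (y s)) :
    ∀ s ∈ Icc (0:ℝ) h, N (y s - q) ≤ b * (∫ s in (0:ℝ)..s, Real.exp (d * s)) := by
  intro s hs
  have key : ∀ t : ℝ, Tendsto (fun δ : ℝ => (b + δ) * (∫ s in (0:ℝ)..t, Real.exp (d * s))
      + δ * Real.exp (d * t)) (𝓝[>] 0) (𝓝 (b * (∫ s in (0:ℝ)..t, Real.exp (d * s)))) := by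
    intro t
    have : Continuous (fun δ : ℝ => (b + δ) * (∫ s in (0:ℝ)..t, Real.exp (d * s))
      + δ * Real.exp (d * t)) := by fun_prop
    have h1 := (this.tendsto 0).mono_left (nhdsWithin_le_nhds (s := Ioi 0))
    simpa using h1
  refine ge_of_tendsto (key s) ?_
  filter_upwards [self_mem_nhdsWithin, ((key h).const_add (N q)).eventually_lt_const hρ] with δ hδ h2
  exact apriori_aux hN F q ρ d b δ h hd hδ hb hos h2 y v hy0 hy hv s hs

/-- Global solution of the truncated equation. -/
theorem exists_cutoff_solution {n : ℕ} {N : (Fin n → ℝ) → ℝ} (hN : IsVecNorm N)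
    (F : (Fin n → ℝ) → (Fin n → ℝ)) (q : Fin n → ℝ) (ρ r h : ℝ) (hρ : ρ < r) (hh : 0 ≤ h)
    (hF : ContDiffOn ℝ 1 F (nball N r)) :
    ∃ y v : ℝ → Fin n → ℝ, y 0 = q ∧
      (∀ s ∈ Icc (0:ℝ) h, HasDerivWithinAt y (v s) (Icc 0 h) s) ∧
      (∀ s, N (y s) < ρ → v s = F (y s)) := by
  obtain ⟨r', hr1, hr2⟩ := exists_between hρ
  obtain ⟨χ, hχ0, hχ1, -⟩ := exists_contMDiffMap_zero_one_of_isClosed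
    (modelWithCornersSelf ℝ (Fin n → ℝ)) (n := 1) (s := {x | r' ≤ N x}) (t := {x | N x ≤ ρ})
    (isClosed_le continuous_const hN.continuous) (isClosed_le hN.continuous continuous_const)
    (Set.disjoint_left.2 fun x (hx : r' ≤ N x) (hx' : N x ≤ ρ) => by linarith)
  have hχd : ContDiff ℝ 1 χ := χ.contMDiff.contDiff
  set G : (Fin n → ℝ) → (Fin n → ℝ) := fun x => χ x • F x with hG
  have hG0 : ∀ x, r' ≤ N x → G x = 0 := fun x hx => by
    have : χ x = 0 := hχ0 hx
    simp [hG, this]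
  have hGd : ContDiff ℝ 1 G := by
    refine contDiff_iff_contDiffAt.2 fun x => ?_
    by_cases hx : N x < r
    · exact hχd.contDiffAt.smul (hF.contDiffAt ((hN.isOpen_nball r).mem_nhds hx))
    · have : G =ᶠ[𝓝 x] fun _ => 0 := by
        have ho : IsOpen {x | r' < N x} := isOpen_lt continuous_const hN.continuous
        filter_upwards [ho.mem_nhds (show r' < N x by push Not at hx; linarith)] with z hz
        exact hG0 z (le_of_lt hz)
      exact contDiffAt_const.congr_of_eventuallyEq this
  have hGs : HasCompactSupport G := by
    refine HasCompactSupport.intro (hN.isCompact_le r') fun x hx => hG0 x ?_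
    simp only [mem_ofPred_eq, not_le] at hx
    exact hx.le
  obtain ⟨K, hK⟩ := ContDiff.lipschitzWith_of_hasCompactSupport hGs hGd (by simp)
  obtain ⟨L, hL⟩ := hGs.exists_bound_of_continuous hGd.continuous
  have hpl : IsPicardLindelof (fun _ : ℝ => G) (tmin := 0) (tmax := h) ⟨0, le_rfl, hh⟩ q
      (L.toNNReal * h.toNNReal) 0 L.toNNReal K := by
    refine ⟨fun t _ => hK.lipschitzOnWith, fun x _ => continuousOn_const,
      fun t _ x _ => (hL x).trans (Real.le_coe_toNNReal L), ?_⟩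
    simp [hh]
  obtain ⟨y, hy0, hy⟩ := hpl.exists_eq_forall_mem_Icc_hasDerivWithinAt₀
  refine ⟨y, fun s => G (y s), hy0, hy, fun s hs => ?_⟩
  have : χ (y s) = 1 := hχ1 (show N (y s) ≤ ρ from hs.le)
  simp [hG, this]

theorem stmt15
    {n m : ℕ} (hn : 0 < n) (hm : 0 < m)
    (f : (Fin n → ℝ) → (Fin m → ℝ) → (Fin n → ℝ)) (g : (Fin n → ℝ) → (Fin m → ℝ))
    (hf : Continuous (fun p : (Fin n → ℝ) × (Fin m → ℝ) => f p.1 p.2)) (hg : Continuous g)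
    (hf0 : f 0 (g 0) = 0)
    -- Assumption 1
    (Ncl : (Fin n → ℝ) → ℝ) (hNcl : IsVecNorm Ncl) (c R₁ : ℝ) (hc : 0 < c) (hR₁ : 0 < R₁)
    (hLip : ∀ x ∈ nball Ncl R₁, ∃ (K : NNReal) (ε : ℝ), 0 < ε ∧
      LipschitzOnWith K (fun y => f y (g y)) (Metric.ball x ε ∩ nball Ncl R₁))
    (hmucl : ∀ᵐ x ∂(volume : Measure (Fin n → ℝ)), x ∈ nball Ncl R₁ →
      DifferentiableAt ℝ (fun y => f y (g y)) x ∧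
      logNorm Ncl (jacobian (fun y => f y (g y)) x) ≤ -c)
    -- Assumption 2
    (Nop : (Fin n → ℝ) → ℝ) (hNop : IsVecNorm Nop) (d₁ d₂ R₂ : ℝ)
    (hd₁ : 0 ≤ d₁) (hd₂ : 0 < d₂) (hR₂ : 0 < R₂)
    (hC1 : ∀ q ∈ nball Nop R₂, ContDiffOn ℝ 1 (fun x => f x (g q)) (nball Nop R₂))
    (hmuop : ∀ q ∈ nball Nop R₂, ∀ x ∈ nball Nop R₂,
      logNorm Nop (jacobian (fun y => f y (g q)) x) ≤ d₁)
    (hfqq : ∀ q ∈ nball Nop R₂, Nop (f q (g q)) ≤ d₂ * Nop q)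
    -- the constants Γ and R
    (Γ R : ℝ) (hΓ : 0 < Γ) (hΓle : ∀ x : Fin n → ℝ, Nop x ≤ Γ * Ncl x)
    (hR : R = min R₁ (R₂ / Γ))
    (σ₀ : ℝ) (hσ₀ : 0 < σ₀)
    -- the zooming quantizer: `‖Q(x) − x‖_op ≤ Δ` whenever `‖x‖_cl < M`
    (M Δ : ℝ) (hM : 0 < M) (hΔ : 0 < Δ)
    (Q : (Fin n → ℝ) → (Fin n → ℝ)) (hQ : ∀ x : Fin n → ℝ, Ncl x < M → Nop (Q x - x) ≤ Δ)
    (lam : ℝ) (hlamI : 0 < lam ∧ lam < 1)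
    (τtmin : ℝ) (hτtmin : 0 < τtmin ∧ lam * (1 + nu d₁ d₂ τtmin) = 1)
    (h σ : ℝ) (hh : 0 < h ∧ h ≤ τtmin) (hσI : 0 < σ ∧ σ ≤ σ₀)
    (hcond : Δ / M * (Real.exp (d₁ * h) + nu d₁ d₂ h) + Γ * nu d₁ d₂ h ≤ σ) :
    ∀ q : Fin n → ℝ, Ncl q < lam * R →
      ∃ xq : ℝ → (Fin n → ℝ),
        (xq 0 = q ∧ ∀ s ∈ Set.Icc (0:ℝ) h, HasDerivWithinAt xq (f (xq s) (g q)) (Set.Icc 0 h) s) ∧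
        (∀ y : ℝ → (Fin n → ℝ), y 0 = q →
          (∀ s ∈ Set.Icc (0:ℝ) h, HasDerivWithinAt y (f (y s) (g q)) (Set.Icc 0 h) s) →
          ∀ s ∈ Set.Icc (0:ℝ) h, y s = xq s) ∧
        (∀ s ∈ Set.Icc (0:ℝ) h, Nop (xq s) < R₂) ∧
        (∀ μ : ℝ, 0 < μ → (∃ x : Fin n → ℝ, Ncl x < M * μ ∧ q = μ • Q (μ⁻¹ • x)) →
          ∀ s ∈ Set.Icc (0:ℝ) h, Δ * μ * Real.exp (d₁ * s) + Nop (xq s - q) < σ * M * μ) := by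
  intro q hq
  have hlam := hlamI.1
  have hI : ∀ t, nu d₁ d₂ t = d₂ * ∫ s in (0:ℝ)..t, Real.exp (d₁ * s) := fun t => rfl
  have hnumono : ∀ s t, s ≤ t → nu d₁ d₂ s ≤ nu d₁ d₂ t := fun s t hst =>
    mul_le_mul_of_nonneg_left (expInt_mono d₁ hst) hd₂.le
  have hnupos : 0 < nu d₁ d₂ h := mul_pos hd₂ (expInt_pos d₁ hh.1)
  have hNq0 := hNop.nonneg q
  have hqlam : Nop q < lam * R₂ := by
    have h1 := hΓle q
    have h2 : R ≤ R₂ / Γ := hR ▸ min_le_right _ _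
    have h3 : Γ * R ≤ R₂ := by
      rw [le_div_iff₀ hΓ] at h2; linarith
    have h4 : Γ * Ncl q < Γ * (lam * R) := mul_lt_mul_of_pos_left hq hΓ
    have h5 : lam * (Γ * R) ≤ lam * R₂ := mul_le_mul_of_nonneg_left h3 hlam.le
    linarith
  have hbound : Nop q + (d₂ * Nop q) * (∫ s in (0:ℝ)..h, Real.exp (d₁ * s)) < R₂ := by
    have h1 : Nop q + (d₂ * Nop q) * (∫ s in (0:ℝ)..h, Real.exp (d₁ * s))
        = Nop q * (1 + nu d₁ d₂ h) := by rw [hI]; ring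
    have h2 := hnumono h τtmin hh.2
    rw [h1]
    calc Nop q * (1 + nu d₁ d₂ h) < (lam * R₂) * (1 + nu d₁ d₂ h) :=
          mul_lt_mul_of_pos_right hqlam (by linarith)
      _ ≤ (lam * R₂) * (1 + nu d₁ d₂ τtmin) :=
          mul_le_mul_of_nonneg_left (by linarith) (by positivity)
      _ = R₂ * (lam * (1 + nu d₁ d₂ τtmin)) := by ring
      _ = R₂ := by rw [hτtmin.2, mul_one]
  have hqR : q ∈ nball Nop R₂ := by
    show Nop q < R₂
    have := mul_lt_mul_of_pos_right hlamI.2 hR₂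
    linarith
  have hos : ∀ x, Nop x < R₂ → ∀ l : (Fin n → ℝ) →L[ℝ] ℝ, l (x - q) = Nop (x - q) →
      (∀ x, l x ≤ Nop x) → l (f x (g q) - f q (g q)) ≤ d₁ * Nop (x - q) := fun x hx l h1 h2 =>
    hNop.one_sided hn (fun x => f x (g q)) R₂ d₁ (hC1 q hqR) (hmuop q hqR) q x hqR hx l h1 h2
  obtain ⟨ρ, hρ1, hρ2⟩ := exists_between hbound
  obtain ⟨x, v, hx0, hx, hxv⟩ := exists_cutoff_solution hNop (fun x => f x (g q)) q ρ R₂ h hρ2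
    hh.1.le (hC1 q hqR)
  have hest := apriori hNop (fun x => f x (g q)) q ρ d₁ (d₂ * Nop q) h hd₁ (hfqq q hqR)
    (fun x hx => hos x (hx.trans hρ2)) hρ1 x v hx0 hx hxv
  have hball : ∀ y : ℝ → Fin n → ℝ,
      (∀ s ∈ Icc (0:ℝ) h, Nop (y s - q) ≤
        (d₂ * Nop q) * (∫ s in (0:ℝ)..s, Real.exp (d₁ * s))) →
      ∀ s ∈ Icc (0:ℝ) h, Nop (y s) < ρ := by
    intro y hy s hs
    have h1 := hy s hs
    have h2 := hNop.sub_le (y s) q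
    have h3 := mul_le_mul_of_nonneg_left (expInt_mono d₁ hs.2)
      (mul_nonneg hd₂.le hNq0)
    simp only at h3
    linarith
  have hxb := hball x hest
  have hx' : ∀ s ∈ Icc (0:ℝ) h, HasDerivWithinAt x (f (x s) (g q)) (Icc 0 h) s := by
    intro s hs
    have h1 := hx s hs
    rwa [hxv s (hxb s hs)] at h1
  refine ⟨x, ⟨hx0, hx'⟩, ?_, fun s hs => (hxb s hs).trans hρ2, ?_⟩
  · intro y hy0 hy
    have hyest := apriori hNop (fun x => f x (g q)) q R₂ d₁ (d₂ * Nop q) h hd₁ (hfqq q hqR)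
      hos hbound y (fun s => f (y s) (g q)) hy0 hy (fun s _ => rfl)
    have hyb := hball y hyest
    have hcx : Convex ℝ {x | Nop x ≤ ρ} := by
      have := hNop.convexOn.convex_le ρ
      simpa using this
    obtain ⟨K, hK⟩ := ((hC1 q hqR).mono
      (fun z (hz : Nop z ≤ ρ) => (lt_of_le_of_lt hz hρ2 : Nop z < R₂))).exists_lipschitzOnWith
      (by simp) hcx (hNop.isCompact_le ρ)
    have hright : ∀ z : ℝ → Fin n → ℝ,
        (∀ s ∈ Icc (0:ℝ) h, HasDerivWithinAt z (f (z s) (g q)) (Icc 0 h) s) →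
        ∀ t ∈ Ico (0:ℝ) h, HasDerivWithinAt z (f (z t) (g q)) (Ici t) t := by
      intro z hz t ht
      exact (hz t (Ico_subset_Icc_self ht)).mono_of_mem_nhdsWithin
        (Icc_mem_nhdsGE_of_mem ht)
    exact ODE_solution_unique_of_mem_Icc_right (v := fun _ x => f x (g q))
      (s := fun _ => {x | Nop x ≤ ρ}) (fun t _ => hK)
      (fun s hs => (hy s hs).continuousWithinAt) (hright y hy)
      (fun t ht => (hyb t (Ico_subset_Icc_self ht)).le)
      (fun s hs => (hx' s hs).continuousWithinAt) (hright x hx')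
      (fun t ht => (hxb t (Ico_subset_Icc_self ht)).le) (hy0.trans hx0.symm)
  · rintro μ hμ ⟨z, hz, hqz⟩ s hs
    have h1 : Ncl (μ⁻¹ • z) < M := by
      rw [hNcl.smul_eq, abs_of_pos (by positivity), inv_mul_lt_iff₀ hμ]
      linarith
    have h2 := hQ _ h1
    have h3 : q - z = μ • (Q (μ⁻¹ • z) - μ⁻¹ • z) := by
      rw [smul_sub, ← hqz, smul_smul, mul_inv_cancel₀ hμ.ne', one_smul]
    have h4 : Nop (q - z) ≤ Δ * μ := by
      rw [h3, hNop.smul_eq, abs_of_pos hμ, mul_comm]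
      exact mul_le_mul_of_nonneg_right h2 hμ.le
    have h5 : Nop q < Δ * μ + Γ * (M * μ) := by
      have h6 := hNop.sub_le q z
      have h7 := hΓle z
      have h8 := mul_lt_mul_of_pos_left hz hΓ
      linarith
    have h9 : Nop (x s - q) ≤ Nop q * nu d₁ d₂ h := by
      refine (hest s hs).trans ?_
      have h10 := mul_le_mul_of_nonneg_left (hnumono s h hs.2) hNq0
      rw [hI s] at h10
      linarith
    have h11 : Nop q * nu d₁ d₂ h < (Δ * μ + Γ * (M * μ)) * nu d₁ d₂ h :=
      mul_lt_mul_of_pos_right h5 hnupos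
    have h12 : Δ * μ * Real.exp (d₁ * s) ≤ Δ * μ * Real.exp (d₁ * h) :=
      mul_le_mul_of_nonneg_left
        (Real.exp_le_exp.2 (mul_le_mul_of_nonneg_left hs.2 hd₁)) (by positivity)
    have h13 := mul_le_mul_of_nonneg_right hcond (mul_pos hM hμ).le
    have h14 : (Δ / M * (Real.exp (d₁ * h) + nu d₁ d₂ h) + Γ * nu d₁ d₂ h) * (M * μ)
        = Δ * μ * Real.exp (d₁ * h) + (Δ * μ + Γ * (M * μ)) * nu d₁ d₂ h := by
      field_simp
      ring
    rw [h14] at h13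
    linarith

end
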